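/- Let K ≥ 2, let α ∈ ℝ^K with α_k > 0 for all k, let α_0 = Σ_k α_k, let μ, ν > 0, let i ≠ j be indices in {1,…,K}, and set η = μα_i / (μα_i + να_j). Then: (a) ∫_0^1 ∫_Δ θ_i² · L_{ij}(θ,ρ) · D_α(θ) · W_{μ,ν}(ρ) dθ dρ = [η·(α_i+1)(α_i+2)(α_i+α_j)/(α_0(α_0+1)(α_i+α_j+2)) + (1−η)·α_i(α_i+1)(α_i+α_j)/(α_0(α_0+1)(α_i+α_j+2))] · ∫_0^1 ∫_Δ L_{ij} · D_α · W_{μ,ν} dθ dρ; (b) ∫_0^1 ∫_Δ θ_j² · L_{ij} · D_α · W_{μ,ν} dθ dρ = [η·α_j(α_j+1)(α_i+α_j)/(α_0(α_0+1)(α_i+α_j+2)) + (1−η)·(α_j+1)(α_j+2)(α_i+α_j)/(α_0(α_0+1)(α_i+α_j+2))] · ∫_0^1 ∫_Δ L_{ij} · D_α · W_{μ,ν} dθ dρ; (c) for every index k with k ≠ i and k ≠ j, ∫_0^1 ∫_Δ θ_k² · L_{ij} · D_α · W_{μ,ν} dθ dρ = [α_k(α_k+1)/(α_0(α_0+1))]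 · ∫_0^1 ∫_Δ L_{ij} · D_α · W_{μ,ν} dθ dρ. -/

import Mathlib

open MeasureTheory Finset

/-- The parametrizing domain `{y ∈ ℝ^{K-1} : y_k > 0, Σ y_k < 1}` of the open
probability simplex on `K` coordinates. -/
def simplexDomain (K : ℕ) : Set (Fin (K - 1) → ℝ) :=
  {y | (∀ k, 0 < y k) ∧ ∑ k, y k < 1}

/-- The point of the simplex with coordinates `θ_k = y_k` for `k < K-1` and
`θ_K = 1 - Σ y_k`. -/
noncomputable def coordsOf {K : ℕ} (y : Fin (K - 1) → ℝ) : Fin K → ℝ :=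
  fun i => if h : (i : ℕ) < K - 1 then y ⟨(i : ℕ), h⟩ else 1 - ∑ k, y k

/-- The unnormalized Dirichlet density `D_α(θ) = ∏ θ_k^(α_k - 1)`. -/
noncomputable def dirDensity {K : ℕ} (α : Fin K → ℝ) (θ : Fin K → ℝ) : ℝ :=
  ∏ k, θ k ^ (α k - 1)

/-- The unnormalized Beta density `W_{μ,ν}(ρ) = ρ^(μ-1) (1-ρ)^(ν-1)`. -/
noncomputable def betaDensity (μ ν ρ : ℝ) : ℝ :=
  ρ ^ (μ - 1) * (1 - ρ) ^ (ν - 1)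

/-- `L_{ij}(θ,ρ) = ρ θ_i/(θ_i+θ_j) + (1-ρ) θ_j/(θ_i+θ_j)`, the probability that
a worker of reliability `ρ` prefers item `i` to item `j`. -/
noncomputable def likeL {K : ℕ} (i j : Fin K) (θ : Fin K → ℝ) (ρ : ℝ) : ℝ :=
  ρ * (θ i / (θ i + θ j)) + (1 - ρ) * (θ j / (θ i + θ j))

/-- `∫_0^1 ∫_Δ f(θ,ρ) dθ dρ`, the double integral over the simplex (via the
standard parametrization) and the unit interval. -/
noncomputable def dblIntegral (K : ℕ) (f : (Fin K → ℝ) → ℝ → ℝ) : ℝ :=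
  ∫ ρ in Set.Ioo (0:ℝ) 1, ∫ y in simplexDomain K, f (coordsOf y) ρ

/-- The point of the affine hyperplane `∑ θ_k = 1` whose first `n` coordinates are `y`. -/
def hyperplanePoint {n : ℕ} (y : Fin n → ℝ) : Fin (n + 1) → ℝ :=
  Fin.snoc (α := fun _ => ℝ) y (1 - ∑ k, y k)

@[simp] lemma hyperplanePoint_castSucc {n : ℕ} (y : Fin n → ℝ) (k : Fin n) :
    hyperplanePoint y k.castSucc = y k := by
  simp [hyperplanePoint]

@[simp] lemma hyperplanePoint_last {n : ℕ} (y : Fin n → ℝ) :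
    hyperplanePoint y (Fin.last n) = 1 - ∑ k, y k := by
  simp [hyperplanePoint]

lemma sum_hyperplanePoint {n : ℕ} (y : Fin n → ℝ) : ∑ k, hyperplanePoint y k = 1 := by
  simp [Fin.sum_univ_castSucc]

@[fun_prop] lemma measurable_hyperplanePoint {n : ℕ} :
    Measurable (hyperplanePoint : (Fin n → ℝ) → Fin (n + 1) → ℝ) := by
  refine measurable_pi_iff.2 fun k => ?_
  refine Fin.lastCases ?_ (fun i => ?_) k
  · simp only [hyperplanePoint_last]; fun_prop
  · simp only [hyperplanePoint_castSucc]; fun_prop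

/-- Points with positive coordinates. -/
def positiveOrthant (n : ℕ) : Set (Fin n → ℝ) := {θ | ∀ k, 0 < θ k}

lemma measurableSet_positiveOrthant (n : ℕ) : MeasurableSet (positiveOrthant n) := by
  have h : positiveOrthant n = Set.univ.pi fun _ => Set.Ioi 0 := by
    ext θ; simp [positiveOrthant]
  rw [h]
  exact MeasurableSet.univ_pi fun _ => measurableSet_Ioi

lemma hyperplanePoint_mem_positiveOrthant {n : ℕ} (y : Fin n → ℝ) :
    hyperplanePoint y ∈ positiveOrthant (n + 1) ↔ (∀ k, 0 < y k) ∧ ∑ k, y k < 1 := by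
  simp [positiveOrthant, Fin.forall_fin_succ']

/-- The lower integral over the open simplex, in the coordinates `θ_1, …, θ_n`. -/
noncomputable def simplexLIntegral (n : ℕ) (f : (Fin (n + 1) → ℝ) → ENNReal) : ENNReal :=
  ∫⁻ y : Fin n → ℝ, (positiveOrthant (n + 1)).indicator f (hyperplanePoint y)

lemma measurable_indicator_hyperplanePoint {n : ℕ} {f : (Fin (n + 1) → ℝ) → ENNReal}
    (hf : Measurable f) :
    Measurable fun y => (positiveOrthant (n + 1)).indicator f (hyperplanePoint y) :=
  (hf.indicator (measurableSet_positiveOrthant _)).comp measurable_hyperplanePoint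

lemma simplexLIntegral_congr {n : ℕ} {f g : (Fin (n + 1) → ℝ) → ENNReal}
    (h : ∀ θ ∈ positiveOrthant (n + 1), ∑ k, θ k = 1 → f θ = g θ) :
    simplexLIntegral n f = simplexLIntegral n g := by
  refine lintegral_congr fun y => ?_
  by_cases hy : hyperplanePoint y ∈ positiveOrthant (n + 1)
  · rw [Set.indicator_of_mem hy, Set.indicator_of_mem hy, h _ hy (sum_hyperplanePoint y)]
  · rw [Set.indicator_of_notMem hy, Set.indicator_of_notMem hy]

lemma simplexLIntegral_const_mul {n : ℕ} (c : ENNReal) {f : (Fin (n + 1) → ℝ) → ENNReal}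
    (hf : Measurable f) :
    simplexLIntegral n (fun θ => c * f θ) = c * simplexLIntegral n f := by
  unfold simplexLIntegral
  rw [← lintegral_const_mul c (measurable_indicator_hyperplanePoint hf)]
  refine lintegral_congr fun y => ?_
  by_cases hy : hyperplanePoint y ∈ positiveOrthant (n + 1) <;> simp [hy]

lemma simplexLIntegral_sum {n : ℕ} {ι : Type*} (s : Finset ι)
    {f : ι → (Fin (n + 1) → ℝ) → ENNReal} (hf : ∀ a ∈ s, Measurable (f a)) :
    simplexLIntegral n (fun θ => ∑ a ∈ s, f a θ) = ∑ a ∈ s, simplexLIntegral n (f a) := by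
  unfold simplexLIntegral
  rw [← lintegral_finsetSum s fun a ha =>
    measurable_indicator_hyperplanePoint (hf a ha)]
  refine lintegral_congr fun y => ?_
  by_cases hy : hyperplanePoint y ∈ positiveOrthant (n + 1) <;> simp [hy]

lemma simplexLIntegral_add {n : ℕ} {f g : (Fin (n + 1) → ℝ) → ENNReal}
    (hf : Measurable f) :
    simplexLIntegral n (fun θ => f θ + g θ) = simplexLIntegral n f + simplexLIntegral n g := by
  unfold simplexLIntegral
  rw [← lintegral_add_left (measurable_indicator_hyperplanePoint hf)]
  refine lintegral_congr fun y => ?_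
  by_cases hy : hyperplanePoint y ∈ positiveOrthant (n + 1) <;> simp [hy]

/-- Tonelli's theorem, integrating along the `i`-th coordinate first. -/
lemma lintegral_insertNth {n : ℕ} (i : Fin (n + 1)) {F : (Fin (n + 1) → ℝ) → ENNReal}
    (hF : Measurable F) :
    ∫⁻ y, F y = ∫⁻ z : Fin n → ℝ, ∫⁻ t : ℝ, F (i.insertNth (α := fun _ => ℝ) t z) := by
  have hp := (volume_preserving_piFinSuccAbove (fun _ : Fin (n + 1) => ℝ) i).symm
  rw [← hp.lintegral_comp hF]
  exact lintegral_prod_symm _ (hF.comp (MeasurableEquiv.measurable _)).aemeasurable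

lemma hyperplanePoint_insertNth_reflect {n : ℕ} (j : Fin (n + 1)) (t : ℝ) (z : Fin n → ℝ) :
    hyperplanePoint (j.insertNth (α := fun _ => ℝ) (1 - ∑ k, z k - t) z) =
      hyperplanePoint (j.insertNth (α := fun _ => ℝ) t z) ∘
        Equiv.swap j.castSucc (Fin.last (n + 1)) := by
  funext k
  refine Fin.lastCases ?_ (fun i => ?_) k
  · simp only [hyperplanePoint_last, Function.comp_apply, Equiv.swap_apply_right,
      hyperplanePoint_castSucc, Fin.insertNth_apply_same, Fin.sum_univ_succAbove _ j,
      Fin.insertNth_apply_succAbove]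
    ring
  · refine Fin.succAboveCases j ?_ (fun l => ?_) i
    · simp [Fin.sum_univ_succAbove _ j]; ring
    · rw [Function.comp_apply, Equiv.swap_apply_of_ne_of_ne]
      · simp
      · simp [Fin.succAbove_ne]
      · exact (Fin.castSucc_lt_last _).ne

lemma simplexLIntegral_comp_swap_last {n : ℕ} (j : Fin (n + 1))
    {f : (Fin (n + 2) → ℝ) → ENNReal} (hf : Measurable f) :
    simplexLIntegral (n + 1) (fun θ => f (θ ∘ Equiv.swap j.castSucc (Fin.last (n + 1)))) =
      simplexLIntegral (n + 1) f := by
  set σ := Equiv.swap j.castSucc (Fin.last (n + 1))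
  have hσ : Measurable fun θ : Fin (n + 2) → ℝ => θ ∘ σ :=
    measurable_pi_iff.2 fun k => measurable_pi_apply _
  have hg := hf.indicator (measurableSet_positiveOrthant (n + 2))
  have key : ∀ θ : Fin (n + 2) → ℝ,
      (positiveOrthant (n + 2)).indicator (fun θ => f (θ ∘ σ)) θ =
        (positiveOrthant (n + 2)).indicator f (θ ∘ σ) := by
    intro θ
    have : θ ∘ σ ∈ positiveOrthant (n + 2) ↔ θ ∈ positiveOrthant (n + 2) :=
      ⟨fun h k => by simpa using h (σ.symm k), fun h k => h (σ k)⟩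
    by_cases h : θ ∈ positiveOrthant (n + 2)
    · rw [Set.indicator_of_mem h, Set.indicator_of_mem (this.2 h)]
    · rw [Set.indicator_of_notMem h, Set.indicator_of_notMem (mt this.1 h)]
  unfold simplexLIntegral
  simp_rw [key]
  rw [lintegral_insertNth j (measurable_indicator_hyperplanePoint hf),
    lintegral_insertNth j (F := fun y => (positiveOrthant (n + 2)).indicator f
      (hyperplanePoint y ∘ σ)) ((hg.comp hσ).comp measurable_hyperplanePoint)]
  refine lintegral_congr fun z => ?_
  rw [← lintegral_sub_left_eq_self _ (1 - ∑ k, z k)]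
  refine lintegral_congr fun t => ?_
  simp only [hyperplanePoint_insertNth_reflect]
  congr 1
  funext k
  simp [σ]

lemma intervalIntegrable_rpow_mul_sub_rpow {a b : ℝ} (ha : 0 < a) (hb : 0 ≤ b) (r : ℝ) :
    IntervalIntegrable (fun t => t ^ (a - 1) * (r - t) ^ b) volume 0 r :=
  (intervalIntegral.intervalIntegrable_rpow' (by linarith)).mul_continuousOn
    (((continuous_const.sub continuous_id).rpow_const fun _ => Or.inr hb).continuousOn)

lemma intervalIntegrable_rpow_mul_sub_rpow' {a b : ℝ} (ha : 0 ≤ a) (hb : 0 < b) (r : ℝ) :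
    IntervalIntegrable (fun t => t ^ a * (r - t) ^ (b - 1)) volume 0 r := by
  have h := ((intervalIntegrable_rpow_mul_sub_rpow hb ha r).comp_sub_left r).symm
  simp only [sub_zero, sub_self, sub_sub_cancel] at h
  exact h.congr (fun t _ => mul_comm _ _)

/-- Integration by parts for the incomplete Beta weights on `(0, r)`. -/
lemma integral_rpow_mul_sub_rpow {a b r : ℝ} (ha : 0 < a) (hb : 0 < b) (hr : 0 < r) :
    a * ∫ t in Set.Ioo 0 r, t ^ (a - 1) * (r - t) ^ b =
      b * ∫ t in Set.Ioo 0 r, t ^ a * (r - t) ^ (b - 1) := by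
  have h1 := (intervalIntegrable_rpow_mul_sub_rpow ha hb.le r).const_mul a
  have h2 := (intervalIntegrable_rpow_mul_sub_rpow' ha.le hb r).const_mul b
  have h := intervalIntegral.integral_eq_sub_of_hasDerivAt_of_le (a := 0) (b := r)
    (f := fun t => t ^ a * (r - t) ^ b) hr.le
    (((continuous_id.rpow_const fun _ => Or.inr ha.le).mul
      ((continuous_const.sub continuous_id).rpow_const fun _ => Or.inr hb.le)).continuousOn)
    (fun t ht => by
      have d1 := Real.hasDerivAt_rpow_const (x := t) (p := a) (Or.inl ht.1.ne')
      have d2 := ((hasDerivAt_id t).const_sub r).rpow_const (p := b)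
        (Or.inl (sub_pos.2 ht.2).ne')
      refine (d1.mul d2).congr_deriv ?_
      show _ = a * (t ^ (a - 1) * (r - t) ^ b) - b * (t ^ a * (r - t) ^ (b - 1))
      simp only [id]
      ring)
    (h1.sub h2)
  rw [intervalIntegral.integral_sub h1 h2, intervalIntegral.integral_const_mul,
    intervalIntegral.integral_const_mul, intervalIntegral.integral_of_le hr.le,
    intervalIntegral.integral_of_le hr.le, integral_Ioc_eq_integral_Ioo,
    integral_Ioc_eq_integral_Ioo] at h
  simp only [sub_self, Real.zero_rpow ha.ne', Real.zero_rpow hb.ne', zero_mul, mul_zero] at h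
  linarith

lemma lintegral_rpow_mul_sub_rpow {a b : ℝ} (ha : 0 < a) (hb : 0 < b) (r : ℝ) :
    ENNReal.ofReal a * ∫⁻ t in Set.Ioo 0 r, ENNReal.ofReal (t ^ (a - 1) * (r - t) ^ b) =
      ENNReal.ofReal b * ∫⁻ t in Set.Ioo 0 r, ENNReal.ofReal (t ^ a * (r - t) ^ (b - 1)) := by
  rcases le_or_gt r 0 with hr | hr
  · simp [Set.Ioo_eq_empty_of_le hr]
  have nonneg : ∀ p q : ℝ, 0 ≤ᵐ[volume.restrict (Set.Ioo 0 r)] fun t => t ^ p * (r - t) ^ q :=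
    fun p q => (ae_restrict_mem measurableSet_Ioo).mono fun t ht =>
      mul_nonneg (Real.rpow_nonneg ht.1.le _) (Real.rpow_nonneg (sub_pos.2 ht.2).le _)
  rw [← ofReal_integral_eq_lintegral_ofReal
      (((intervalIntegrable_iff_integrableOn_Ioo_of_le hr.le).1
        (intervalIntegrable_rpow_mul_sub_rpow ha hb.le r))) (nonneg _ _),
    ← ofReal_integral_eq_lintegral_ofReal
      (((intervalIntegrable_iff_integrableOn_Ioo_of_le hr.le).1
        (intervalIntegrable_rpow_mul_sub_rpow' ha.le hb r))) (nonneg _ _),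
    ← ENNReal.ofReal_mul ha.le, ← ENNReal.ofReal_mul hb.le, integral_rpow_mul_sub_rpow ha hb hr]

lemma simplexLIntegral_rpow_pair_last {n : ℕ} {a b : ℝ} (ha : 0 < a) (hb : 0 < b)
    (i : Fin (n + 1)) {c : (Fin (n + 2) → ℝ) → ENNReal} (hc : Measurable c)
    (hinv : ∀ θ θ' : Fin (n + 2) → ℝ,
      θ i.castSucc + θ (Fin.last _) = θ' i.castSucc + θ' (Fin.last _) →
      (∀ k, k ≠ i.castSucc → k ≠ Fin.last _ → θ k = θ' k) → c θ = c θ') :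
    ENNReal.ofReal a * simplexLIntegral (n + 1) (fun θ =>
        ENNReal.ofReal (θ i.castSucc ^ (a - 1) * θ (Fin.last _) ^ b) * c θ) =
      ENNReal.ofReal b * simplexLIntegral (n + 1) (fun θ =>
        ENNReal.ofReal (θ i.castSucc ^ a * θ (Fin.last _) ^ (b - 1)) * c θ) := by
  have meas : ∀ p q : ℝ, Measurable fun θ : Fin (n + 2) → ℝ =>
      ENNReal.ofReal (θ i.castSucc ^ p * θ (Fin.last _) ^ q) * c θ := by
    intro p q; fun_prop
  have mem : ∀ (z : Fin n → ℝ) (t : ℝ),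
      hyperplanePoint (i.insertNth (α := fun _ => ℝ) t z) ∈ positiveOrthant (n + 2) ↔
        z ∈ positiveOrthant n ∧ t ∈ Set.Ioo 0 (1 - ∑ k, z k) := by
    intro z t
    rw [hyperplanePoint_mem_positiveOrthant, Fin.forall_iff_succAbove i, Fin.sum_univ_succAbove _ i]
    simp only [Fin.insertNth_apply_same, Fin.insertNth_apply_succAbove, positiveOrthant,
      Set.mem_ofPred_eq, Set.mem_Ioo, lt_sub_iff_add_lt]
    tauto
  have fiber : ∀ p q : ℝ, simplexLIntegral (n + 1) (fun θ =>
      ENNReal.ofReal (θ i.castSucc ^ p * θ (Fin.last _) ^ q) * c θ) =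
      ∫⁻ z : Fin n → ℝ, (positiveOrthant n).indicator (fun z =>
        (∫⁻ t in Set.Ioo 0 (1 - ∑ k, z k), ENNReal.ofReal (t ^ p * (1 - ∑ k, z k - t) ^ q)) *
          c (hyperplanePoint (i.insertNth (α := fun _ => ℝ) 0 z))) z := by
    intro p q
    unfold simplexLIntegral
    rw [lintegral_insertNth i (measurable_indicator_hyperplanePoint (meas p q))]
    refine lintegral_congr fun z => ?_
    by_cases hz : z ∈ positiveOrthant n
    · rw [Set.indicator_of_mem hz, ← lintegral_mul_const _ (by fun_prop),
        ← lintegral_indicator measurableSet_Ioo]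
      refine lintegral_congr fun t => ?_
      by_cases ht : t ∈ Set.Ioo 0 (1 - ∑ k, z k)
      · rw [Set.indicator_of_mem ht, Set.indicator_of_mem ((mem z t).2 ⟨hz, ht⟩)]
        congr 1
        · simp [Fin.sum_univ_succAbove _ i, sub_sub, add_comm]
        · refine hinv _ _ ?_ fun k hk hk' => ?_
          · simp [Fin.sum_univ_succAbove _ i, sub_add_eq_sub_sub_swap]
          · obtain ⟨l, rfl⟩ := Fin.exists_castSucc_eq.2 hk'
            obtain ⟨m, rfl⟩ := Fin.exists_succAbove_eq (fun h : l = i => hk (h ▸ rfl))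
            simp
      · rw [Set.indicator_of_notMem ht, Set.indicator_of_notMem fun h => ht ((mem z t).1 h).2]
    · rw [Set.indicator_of_notMem hz]
      refine (lintegral_congr fun t => ?_).trans lintegral_zero
      exact Set.indicator_of_notMem (fun h => hz ((mem z t).1 h).1) _
  rw [fiber, fiber, ← lintegral_const_mul' _ _ ENNReal.ofReal_ne_top,
    ← lintegral_const_mul' _ _ ENNReal.ofReal_ne_top]
  refine lintegral_congr fun z => ?_
  by_cases hz : z ∈ positiveOrthant n
  · rw [Set.indicator_of_mem hz, Set.indicator_of_mem hz, ← mul_assoc, ← mul_assoc,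
      lintegral_rpow_mul_sub_rpow ha hb]
  · simp [Set.indicator_of_notMem hz]

/-- Integration by parts on the simplex in the direction `e_i - e_j`: the factor `c` depends on
the coordinates `i`, `j` only through their sum. -/
lemma simplexLIntegral_rpow_pair {n : ℕ} {a b : ℝ} (ha : 0 < a) (hb : 0 < b)
    {i j : Fin (n + 2)} (hij : i ≠ j) {c : (Fin (n + 2) → ℝ) → ENNReal} (hc : Measurable c)
    (hinv : ∀ θ θ' : Fin (n + 2) → ℝ, θ i + θ j = θ' i + θ' j →
      (∀ k, k ≠ i → k ≠ j → θ k = θ' k) → c θ = c θ') :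
    ENNReal.ofReal a * simplexLIntegral (n + 1) (fun θ =>
        ENNReal.ofReal (θ i ^ (a - 1) * θ j ^ b) * c θ) =
      ENNReal.ofReal b * simplexLIntegral (n + 1) (fun θ =>
        ENNReal.ofReal (θ i ^ a * θ j ^ (b - 1)) * c θ) := by
  induction i using Fin.lastCases with
  | last =>
    obtain ⟨j, rfl⟩ := Fin.exists_castSucc_eq.2 hij.symm
    have h := simplexLIntegral_rpow_pair_last hb ha j hc fun θ θ' h h' =>
      hinv θ θ' (by linarith) fun k hk hk' => h' k hk' hk
    have hcomm : ∀ (p q : ℝ) (θ : Fin (n + 2) → ℝ), θ (Fin.last _) ^ p * θ j.castSucc ^ q =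
        θ j.castSucc ^ q * θ (Fin.last _) ^ p := fun _ _ _ => mul_comm _ _
    simp only [hcomm]
    exact h.symm
  | cast i =>
    induction j using Fin.lastCases with
    | last => exact simplexLIntegral_rpow_pair_last ha hb i hc hinv
    | cast j =>
      have hs : (Equiv.swap j.castSucc (Fin.last (n + 1))) i.castSucc = i.castSucc :=
        Equiv.swap_apply_of_ne_of_ne hij (Fin.castSucc_lt_last i).ne
      rw [← simplexLIntegral_comp_swap_last j (by fun_prop),
        ← simplexLIntegral_comp_swap_last j (f := fun θ =>
          ENNReal.ofReal (θ i.castSucc ^ a * θ j.castSucc ^ (b - 1)) * c θ) (by fun_prop)]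
      simp only [Function.comp_apply, hs, Equiv.swap_apply_left]
      refine simplexLIntegral_rpow_pair_last ha hb i (c := fun θ => c (θ ∘ _))
        (hc.comp (measurable_pi_iff.2 fun k => measurable_pi_apply _)) fun θ θ' h h' => ?_
      refine hinv _ _ (by simpa [hs] using h) fun k hk hk' => ?_
      by_cases hl : k = Fin.last _
      · subst hl
        simpa using h' j.castSucc (Ne.symm hij) (Fin.castSucc_lt_last j).ne
      · simpa [Equiv.swap_apply_of_ne_of_ne hk' hl] using h' k hk hl

@[fun_prop] lemma measurable_dirDensity {K : ℕ} (β : Fin K → ℝ) : Measurable (dirDensity β) := by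
  unfold dirDensity
  fun_prop

lemma dirDensity_nonneg {K : ℕ} (β : Fin K → ℝ) {θ : Fin K → ℝ} (hθ : θ ∈ positiveOrthant K) :
    0 ≤ dirDensity β θ :=
  prod_nonneg fun k _ => Real.rpow_nonneg (hθ k).le _

lemma dirDensity_add_single {K : ℕ} (β : Fin K → ℝ) (k : Fin K) {θ : Fin K → ℝ}
    (hθ : θ ∈ positiveOrthant K) :
    dirDensity (β + Pi.single k 1) θ = θ k * dirDensity β θ := by
  unfold dirDensity
  rw [← mul_prod_erase univ _ (mem_univ k), ← mul_prod_erase univ _ (mem_univ k), ← mul_assoc]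
  congr 1
  · rw [Pi.add_apply, Pi.single_eq_same, add_sub_right_comm, Real.rpow_add_one (hθ k).ne', mul_comm]
  · refine prod_congr rfl fun l hl => ?_
    simp [Pi.single_eq_of_ne (ne_of_mem_erase hl)]

lemma add_single_pos {K : ℕ} {β : Fin K → ℝ} (hβ : ∀ k, 0 < β k) (k l : Fin K) :
    0 < (β + Pi.single k 1 : Fin K → ℝ) l := by
  refine add_pos_of_pos_of_nonneg (hβ l) ?_
  rcases eq_or_ne l k with rfl | h <;> simp [*]

lemma simplexLIntegral_dirDensity_pair {n : ℕ} {β : Fin (n + 2) → ℝ} (hβ : ∀ k, 0 < β k)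
    {i j : Fin (n + 2)} (hij : i ≠ j) {g : ℝ → ENNReal} (hg : Measurable g) :
    ENNReal.ofReal (β j) * simplexLIntegral (n + 1) (fun θ =>
        ENNReal.ofReal (θ i * dirDensity β θ) * g (θ i + θ j)) =
      ENNReal.ofReal (β i) * simplexLIntegral (n + 1) (fun θ =>
        ENNReal.ofReal (θ j * dirDensity β θ) * g (θ i + θ j)) := by
  have split : ∀ θ : Fin (n + 2) → ℝ, dirDensity β θ =
      θ i ^ (β i - 1) * (θ j ^ (β j - 1) * ∏ k ∈ (univ.erase i).erase j, θ k ^ (β k - 1)) := by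
    intro θ
    rw [mul_prod_erase _ (fun k => θ k ^ (β k - 1)) (mem_erase.2 ⟨hij.symm, mem_univ j⟩),
      mul_prod_erase _ (fun k => θ k ^ (β k - 1)) (mem_univ i)]
    rfl
  have h := simplexLIntegral_rpow_pair (hβ i) (hβ j) hij
    (c := fun θ => ENNReal.ofReal (∏ k ∈ (univ.erase i).erase j, θ k ^ (β k - 1)) * g (θ i + θ j))
    (by fun_prop) (fun θ θ' h h' => by
      rw [h, prod_congr rfl fun k hk => ?_]
      rw [h' k (ne_of_mem_erase (mem_of_mem_erase hk)) (ne_of_mem_erase hk)])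
  have shift : ∀ {x : ℝ} (p : ℝ), 0 < x → x ^ p = x * x ^ (p - 1) := fun {x} p hx => by
    rw [Real.rpow_sub_one hx.ne', mul_div_cancel₀ _ hx.ne']
  refine (Eq.trans ?_ h.symm).trans ?_
  · congr 1
    refine simplexLIntegral_congr fun θ hθ _ => ?_
    have h1 := hθ i
    have h2 := hθ j
    rw [← mul_assoc, ← ENNReal.ofReal_mul (by positivity), split, shift (β i) h1]
    congr 2
    ring
  · congr 1
    refine simplexLIntegral_congr fun θ hθ _ => ?_
    have h1 := hθ i
    have h2 := hθ j
    rw [← mul_assoc, ← ENNReal.ofReal_mul (by positivity), split, shift (β j) h2]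
    congr 2
    ring

lemma ENNReal.eq_ofReal_div_mul {a b : ℝ} (ha : 0 < a) {X Y : ENNReal}
    (h : ENNReal.ofReal a * X = ENNReal.ofReal b * Y) : X = ENNReal.ofReal (b / a) * Y := by
  rw [ENNReal.ofReal_div_of_pos ha, ENNReal.div_eq_inv_mul, mul_assoc, ← h, ← mul_assoc,
    ENNReal.inv_mul_cancel (ENNReal.ofReal_pos.2 ha).ne' ENNReal.ofReal_ne_top, one_mul]

/-- First moments of the Dirichlet distribution, without normalization. -/
lemma simplexLIntegral_mul_dirDensity {n : ℕ} {β : Fin (n + 2) → ℝ} (hβ : ∀ k, 0 < β k)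
    (i : Fin (n + 2)) :
    simplexLIntegral (n + 1) (fun θ => ENNReal.ofReal (θ i * dirDensity β θ)) =
      ENNReal.ofReal (β i / ∑ k, β k) *
        simplexLIntegral (n + 1) (fun θ => ENNReal.ofReal (dirDensity β θ)) := by
  refine ENNReal.eq_ofReal_div_mul (sum_pos (fun k _ => hβ k) univ_nonempty) ?_
  rw [ENNReal.ofReal_sum_of_nonneg fun k _ => (hβ k).le, sum_mul]
  have h : ∀ k, ENNReal.ofReal (β k) *
      simplexLIntegral (n + 1) (fun θ => ENNReal.ofReal (θ i * dirDensity β θ)) =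
      ENNReal.ofReal (β i) *
        simplexLIntegral (n + 1) (fun θ => ENNReal.ofReal (θ k * dirDensity β θ)) := by
    intro k
    rcases eq_or_ne i k with rfl | hik
    · rfl
    · simpa using simplexLIntegral_dirDensity_pair hβ hik (g := fun _ => 1) measurable_const
  simp_rw [h]
  rw [← mul_sum, ← simplexLIntegral_sum _ fun k _ => by fun_prop]
  congr 1
  refine simplexLIntegral_congr fun θ hθ hsum => ?_
  rw [← ENNReal.ofReal_sum_of_nonneg fun k _ => mul_nonneg (hθ k).le (dirDensity_nonneg β hθ),
    ← sum_mul, hsum, one_mul]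

lemma simplexLIntegral_dirDensity_add_single {n : ℕ} {β : Fin (n + 2) → ℝ} (hβ : ∀ k, 0 < β k)
    (i : Fin (n + 2)) :
    simplexLIntegral (n + 1) (fun θ => ENNReal.ofReal (dirDensity (β + Pi.single i 1) θ)) =
      ENNReal.ofReal (β i / ∑ k, β k) *
        simplexLIntegral (n + 1) (fun θ => ENNReal.ofReal (dirDensity β θ)) := by
  rw [← simplexLIntegral_mul_dirDensity hβ]
  exact simplexLIntegral_congr fun θ hθ _ => by rw [dirDensity_add_single β i hθ]

lemma simplexLIntegral_div_mul_dirDensity {n : ℕ} {β : Fin (n + 2) → ℝ} (hβ : ∀ k, 0 < β k)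
    {i j : Fin (n + 2)} (hij : i ≠ j) :
    simplexLIntegral (n + 1) (fun θ => ENNReal.ofReal (θ i / (θ i + θ j) * dirDensity β θ)) =
      ENNReal.ofReal (β i / (β i + β j)) *
        simplexLIntegral (n + 1) (fun θ => ENNReal.ofReal (dirDensity β θ)) := by
  have h := simplexLIntegral_dirDensity_pair hβ hij (g := fun s => ENNReal.ofReal s⁻¹)
    (by fun_prop)
  have conv : ∀ k, simplexLIntegral (n + 1) (fun θ =>
        ENNReal.ofReal (θ k * dirDensity β θ) * ENNReal.ofReal (θ i + θ j)⁻¹) =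
      simplexLIntegral (n + 1) (fun θ =>
        ENNReal.ofReal (θ k / (θ i + θ j) * dirDensity β θ)) := fun k =>
    simplexLIntegral_congr fun θ hθ _ => by
      rw [← ENNReal.ofReal_mul (mul_nonneg (hθ k).le (dirDensity_nonneg β hθ))]
      congr 1
      ring
  rw [conv, conv] at h
  refine ENNReal.eq_ofReal_div_mul (add_pos (hβ i) (hβ j)) ?_
  rw [ENNReal.ofReal_add (hβ i).le (hβ j).le, add_mul, h, ← mul_add,
    ← simplexLIntegral_add (by fun_prop)]
  congr 1
  refine simplexLIntegral_congr fun θ hθ _ => ?_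
  have h1 := hθ i
  have h2 := hθ j
  have h3 := dirDensity_nonneg β hθ
  rw [← ENNReal.ofReal_add (by positivity) (by positivity), ← add_mul, ← add_div,
    div_self (by positivity), one_mul]

lemma simplexLIntegral_likeL_mul_dirDensity {n : ℕ} {β : Fin (n + 2) → ℝ} (hβ : ∀ k, 0 < β k)
    {i j : Fin (n + 2)} (hij : i ≠ j) {ρ : ℝ} (hρ : ρ ∈ Set.Ioo (0 : ℝ) 1) :
    simplexLIntegral (n + 1) (fun θ => ENNReal.ofReal (likeL i j θ ρ * dirDensity β θ)) =
      ENNReal.ofReal ((ρ * β i + (1 - ρ) * β j) / (β i + β j)) *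
        simplexLIntegral (n + 1) (fun θ => ENNReal.ofReal (dirDensity β θ)) := by
  have h0 := hρ.1.le
  have h1 : 0 ≤ 1 - ρ := sub_nonneg.2 hρ.2.le
  have hi := hβ i
  have hj := hβ j
  rw [show (ρ * β i + (1 - ρ) * β j) / (β i + β j) =
      ρ * (β i / (β i + β j)) + (1 - ρ) * (β j / (β j + β i)) by rw [add_comm (β j)]; ring,
    ENNReal.ofReal_add (by positivity) (by positivity), ENNReal.ofReal_mul h0,
    ENNReal.ofReal_mul h1, add_mul, mul_assoc, mul_assoc,
    ← simplexLIntegral_div_mul_dirDensity hβ hij, ← simplexLIntegral_div_mul_dirDensity hβ hij.symm,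
    ← simplexLIntegral_const_mul _ (by fun_prop), ← simplexLIntegral_const_mul _ (by fun_prop),
    ← simplexLIntegral_add (by fun_prop)]
  refine simplexLIntegral_congr fun θ hθ _ => ?_
  have h2 := hθ i
  have h3 := hθ j
  have h4 := dirDensity_nonneg β hθ
  rw [← ENNReal.ofReal_mul h0, ← ENNReal.ofReal_mul h1,
    ← ENNReal.ofReal_add (by positivity) (by positivity), likeL, add_comm (θ j)]
  congr 1
  ring

lemma coordsOf_eq_hyperplanePoint {n : ℕ} (y : Fin (n + 1) → ℝ) :
    coordsOf (K := n + 2) y = hyperplanePoint y := by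
  funext k
  refine Fin.lastCases ?_ (fun i => ?_) k
  · simp [coordsOf]
  · simp [coordsOf, show (i : ℕ) < n + 1 from i.2]

lemma coordsOf_mem_positiveOrthant {n : ℕ} {y : Fin (n + 1) → ℝ}
    (hy : y ∈ simplexDomain (n + 2)) : coordsOf (K := n + 2) y ∈ positiveOrthant (n + 2) := by
  rw [coordsOf_eq_hyperplanePoint]
  exact (hyperplanePoint_mem_positiveOrthant y).2 hy

lemma measurableSet_simplexDomain (n : ℕ) : MeasurableSet (simplexDomain (n + 2)) := by
  have h : simplexDomain (n + 2) =
      (hyperplanePoint : (Fin (n + 1) → ℝ) → _) ⁻¹' positiveOrthant (n + 2) := by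
    ext y
    exact (hyperplanePoint_mem_positiveOrthant (n := n + 1) y).symm
  rw [h]
  exact measurable_hyperplanePoint (measurableSet_positiveOrthant _)

lemma setIntegral_simplexDomain {n : ℕ} {f : (Fin (n + 2) → ℝ) → ℝ} (hf : Measurable f)
    (hpos : ∀ θ ∈ positiveOrthant (n + 2), 0 ≤ f θ) :
    ∫ y in simplexDomain (n + 2), f (coordsOf y) =
      (simplexLIntegral (n + 1) fun θ => ENNReal.ofReal (f θ)).toReal := by
  have hm : Measurable fun y : Fin (n + 1) → ℝ => f (coordsOf (K := n + 2) y) := by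
    simp_rw [coordsOf_eq_hyperplanePoint]
    exact hf.comp measurable_hyperplanePoint
  rw [integral_eq_lintegral_of_nonneg_ae
    ((ae_restrict_mem (measurableSet_simplexDomain n)).mono fun y hy =>
      hpos _ (coordsOf_mem_positiveOrthant hy))
    hm.aestronglyMeasurable, ← lintegral_indicator (measurableSet_simplexDomain n)]
  congr 1
  refine lintegral_congr fun y : Fin (n + 1) → ℝ => ?_
  have hmem : y ∈ simplexDomain (n + 2) ↔ hyperplanePoint y ∈ positiveOrthant (n + 2) :=
    (hyperplanePoint_mem_positiveOrthant y).symm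
  by_cases hy : y ∈ simplexDomain (n + 2)
  · rw [Set.indicator_of_mem hy, Set.indicator_of_mem (hmem.1 hy), coordsOf_eq_hyperplanePoint]
  · rw [Set.indicator_of_notMem hy, Set.indicator_of_notMem (mt hmem.2 hy)]

lemma dblIntegral_congr {n : ℕ} {f g : (Fin (n + 2) → ℝ) → ℝ → ℝ}
    (h : ∀ θ ∈ positiveOrthant (n + 2), ∀ ρ, f θ ρ = g θ ρ) :
    dblIntegral (n + 2) f = dblIntegral (n + 2) g := by
  unfold dblIntegral
  congr 1
  funext ρ
  exact setIntegral_congr_fun (measurableSet_simplexDomain n) fun y hy =>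
    h _ (coordsOf_mem_positiveOrthant hy) ρ

lemma mul_betaDensity (μ ν : ℝ) {ρ : ℝ} (hρ : ρ ∈ Set.Ioo (0 : ℝ) 1) :
    ρ * betaDensity μ ν ρ = ρ ^ μ * (1 - ρ) ^ (ν - 1) := by
  rw [betaDensity, ← mul_assoc, Real.rpow_sub_one hρ.1.ne', mul_div_cancel₀ _ hρ.1.ne']

lemma one_sub_mul_betaDensity (μ ν : ℝ) {ρ : ℝ} (hρ : ρ ∈ Set.Ioo (0 : ℝ) 1) :
    (1 - ρ) * betaDensity μ ν ρ = ρ ^ (μ - 1) * (1 - ρ) ^ ν := by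
  have h : 1 - ρ ≠ 0 := (sub_pos.2 hρ.2).ne'
  rw [betaDensity, mul_left_comm, Real.rpow_sub_one h, mul_div_cancel₀ _ h]

lemma integrableOn_mul_betaDensity {μ ν : ℝ} (hμ : 0 < μ) (hν : 0 < ν) :
    IntegrableOn (fun ρ => ρ * betaDensity μ ν ρ) (Set.Ioo 0 1) :=
  ((intervalIntegrable_iff_integrableOn_Ioo_of_le zero_le_one).1
    (intervalIntegrable_rpow_mul_sub_rpow' hμ.le hν 1)).congr_fun
    (fun _ hρ => (mul_betaDensity μ ν hρ).symm) measurableSet_Ioo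

lemma integrableOn_one_sub_mul_betaDensity {μ ν : ℝ} (hμ : 0 < μ) (hν : 0 < ν) :
    IntegrableOn (fun ρ => (1 - ρ) * betaDensity μ ν ρ) (Set.Ioo 0 1) :=
  ((intervalIntegrable_iff_integrableOn_Ioo_of_le zero_le_one).1
    (intervalIntegrable_rpow_mul_sub_rpow hμ hν.le 1)).congr_fun
    (fun _ hρ => (one_sub_mul_betaDensity μ ν hρ).symm) measurableSet_Ioo

lemma integrableOn_betaDensity {μ ν : ℝ} (hμ : 0 < μ) (hν : 0 < ν) :
    IntegrableOn (betaDensity μ ν) (Set.Ioo 0 1) :=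
  ((integrableOn_mul_betaDensity hμ hν).add
    (integrableOn_one_sub_mul_betaDensity hμ hν)).congr_fun
    (fun ρ _ => by simp only [Pi.add_apply]; ring) measurableSet_Ioo

/-- The mean of the Beta distribution, without normalization. -/
lemma integral_mul_betaDensity {μ ν : ℝ} (hμ : 0 < μ) (hν : 0 < ν) :
    ∫ ρ in Set.Ioo (0 : ℝ) 1, ρ * betaDensity μ ν ρ =
      μ / (μ + ν) * ∫ ρ in Set.Ioo (0 : ℝ) 1, betaDensity μ ν ρ := by
  have h := integral_rpow_mul_sub_rpow hμ hν zero_lt_one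
  rw [← setIntegral_congr_fun measurableSet_Ioo fun _ hρ => mul_betaDensity μ ν hρ,
    ← setIntegral_congr_fun measurableSet_Ioo fun _ hρ => one_sub_mul_betaDensity μ ν hρ] at h
  have hadd := integral_add (integrableOn_mul_betaDensity hμ hν)
    (integrableOn_one_sub_mul_betaDensity hμ hν)
  simp_rw [← add_mul, add_sub_cancel, one_mul] at hadd
  rw [hadd]
  field_simp
  linarith

lemma dblIntegral_likeL {n : ℕ} {β : Fin (n + 2) → ℝ} (hβ : ∀ k, 0 < β k)
    {i j : Fin (n + 2)} (hij : i ≠ j) {μ ν : ℝ} (hμ : 0 < μ) (hν : 0 < ν) :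
    dblIntegral (n + 2) (fun θ ρ => likeL i j θ ρ * dirDensity β θ * betaDensity μ ν ρ) =
      (μ * β i + ν * β j) / ((μ + ν) * (β i + β j)) *
        (∫ ρ in Set.Ioo (0 : ℝ) 1, betaDensity μ ν ρ) *
        (simplexLIntegral (n + 1) fun θ => ENNReal.ofReal (dirDensity β θ)).toReal := by
  set D := (simplexLIntegral (n + 1) fun θ => ENNReal.ofReal (dirDensity β θ)).toReal
  have hi := hβ i
  have hj := hβ j
  have inner : ∀ ρ ∈ Set.Ioo (0 : ℝ) 1,
      ∫ y in simplexDomain (n + 2),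
        likeL i j (coordsOf y) ρ * dirDensity β (coordsOf y) * betaDensity μ ν ρ =
      D / (β i + β j) * ((β i - β j) * (ρ * betaDensity μ ν ρ) + β j * betaDensity μ ν ρ) := by
    intro ρ hρ
    have h0 := hρ.1.le
    have h1 : 0 ≤ 1 - ρ := sub_nonneg.2 hρ.2.le
    rw [integral_mul_const, setIntegral_simplexDomain
      (f := fun θ => likeL i j θ ρ * dirDensity β θ)
      (by unfold likeL; fun_prop)
      (fun θ hθ => by
        have h2 := hθ i
        have h3 := hθ j
        have h4 := dirDensity_nonneg β hθ
        unfold likeL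
        positivity),
      simplexLIntegral_likeL_mul_dirDensity hβ hij hρ, ENNReal.toReal_mul,
      ENNReal.toReal_ofReal (by positivity)]
    ring
  have hint := integrableOn_betaDensity hμ hν
  have hint' := integrableOn_mul_betaDensity hμ hν
  unfold dblIntegral
  rw [setIntegral_congr_fun measurableSet_Ioo inner, integral_const_mul,
    integral_add (hint'.const_mul _) (hint.const_mul _), integral_const_mul, integral_const_mul,
    integral_mul_betaDensity hμ hν]
  field_simp
  ring

/-- Inserting the factor `θ_k²` replaces `α` by `α + 2 e_k` and multiplies by the second
Dirichlet moment. -/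
lemma dblIntegral_sq_mul_likeL {n : ℕ} {α : Fin (n + 2) → ℝ} (hα : ∀ k, 0 < α k)
    {i j : Fin (n + 2)} (hij : i ≠ j) {μ ν : ℝ} (hμ : 0 < μ) (hν : 0 < ν) (k : Fin (n + 2)) :
    dblIntegral (n + 2)
        (fun θ ρ => θ k ^ 2 * (likeL i j θ ρ * dirDensity α θ * betaDensity μ ν ρ)) =
      (μ * (α + Pi.single k 2 : Fin (n + 2) → ℝ) i + ν * (α + Pi.single k 2 : Fin (n + 2) → ℝ) j) /
          (μ * α i + ν * α j) *
        ((α i + α j) / ((α + Pi.single k 2 : Fin (n + 2) → ℝ) i +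
          (α + Pi.single k 2 : Fin (n + 2) → ℝ) j)) *
        (α k * (α k + 1) / ((∑ l, α l) * ((∑ l, α l) + 1))) *
        dblIntegral (n + 2) (fun θ ρ => likeL i j θ ρ * dirDensity α θ * betaDensity μ ν ρ) := by
  have hα₁ := add_single_pos hα k
  have hα₂ := add_single_pos hα₁ k
  have htwo : α + Pi.single k 1 + Pi.single k 1 = α + Pi.single k (2 : ℝ) := by
    rw [add_assoc, ← Pi.single_add, one_add_one_eq_two]
  have hS : 0 < ∑ l, α l := sum_pos (fun l _ => hα l) univ_nonempty
  have hk := hα k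
  have hi := hα i
  have hj := hα j
  have hcongr := dblIntegral_congr
    (f := fun θ ρ => θ k ^ 2 * (likeL i j θ ρ * dirDensity α θ * betaDensity μ ν ρ))
    (g := fun θ ρ => likeL i j θ ρ * dirDensity (α + Pi.single k 1 + Pi.single k 1) θ *
      betaDensity μ ν ρ)
    fun θ hθ ρ => by
      rw [dirDensity_add_single _ k hθ, dirDensity_add_single _ k hθ]
      ring
  rw [hcongr, dblIntegral_likeL hα₂ hij hμ hν, dblIntegral_likeL hα hij hμ hν,
    simplexLIntegral_dirDensity_add_single hα₁, simplexLIntegral_dirDensity_add_single hα,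
    ENNReal.toReal_mul, ENNReal.toReal_mul,
    ENNReal.toReal_ofReal (div_nonneg (hα₁ k).le (sum_nonneg fun l _ => (hα₁ l).le)),
    ENNReal.toReal_ofReal (by positivity)]
  have hsum : ∑ l, (α + Pi.single k 1 : Fin (n + 2) → ℝ) l = ∑ l, α l + 1 := by
    simp [sum_add_distrib]
  have hi₂ := hα₂ i
  have hj₂ := hα₂ j
  rw [hsum]
  rw [htwo] at hi₂ hj₂ ⊢
  rw [Pi.add_apply α (Pi.single k 1) k, Pi.single_eq_same]
  generalize (α + Pi.single k 2 : Fin (n + 2) → ℝ) i = x at *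
  generalize (α + Pi.single k 2 : Fin (n + 2) → ℝ) j = y at *
  field_simp

/-- Posterior second moments of the item scores after one comparison by a worker
with Beta(μ,ν)-distributed reliability, in which item `i` is preferred to `j`. -/
theorem heterogeneous_posterior_second_moments (K : ℕ) (hK : 2 ≤ K)
    (α : Fin K → ℝ) (hα : ∀ k, 0 < α k) (μ ν : ℝ) (hμ : 0 < μ) (hν : 0 < ν)
    (i j : Fin K) (hij : i ≠ j) (η : ℝ) (hη : η = μ * α i / (μ * α i + ν * α j)) :
    (dblIntegral K (fun θ ρ => θ i ^ 2 * (likeL i j θ ρ * dirDensity α θ * betaDensity μ ν ρ))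
      = (η * ((α i + 1) * (α i + 2) * (α i + α j)
              / ((∑ k, α k) * ((∑ k, α k) + 1) * (α i + α j + 2)))
          + (1 - η) * (α i * (α i + 1) * (α i + α j)
              / ((∑ k, α k) * ((∑ k, α k) + 1) * (α i + α j + 2))))
        * dblIntegral K (fun θ ρ => likeL i j θ ρ * dirDensity α θ * betaDensity μ ν ρ)) ∧
    (dblIntegral K (fun θ ρ => θ j ^ 2 * (likeL i j θ ρ * dirDensity α θ * betaDensity μ ν ρ))
      = (η * (α j * (α j + 1) * (α i + α j)
              / ((∑ k, α k) * ((∑ k, α k) + 1) * (α i + α j + 2)))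
          + (1 - η) * ((α j + 1) * (α j + 2) * (α i + α j)
              / ((∑ k, α k) * ((∑ k, α k) + 1) * (α i + α j + 2))))
        * dblIntegral K (fun θ ρ => likeL i j θ ρ * dirDensity α θ * betaDensity μ ν ρ)) ∧
    (∀ k : Fin K, k ≠ i → k ≠ j →
      dblIntegral K (fun θ ρ => θ k ^ 2 * (likeL i j θ ρ * dirDensity α θ * betaDensity μ ν ρ))
        = (α k * (α k + 1) / ((∑ k', α k') * ((∑ k', α k') + 1)))
          * dblIntegral K (fun θ ρ => likeL i j θ ρ * dirDensity α θ * betaDensity μ ν ρ)) := by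
  obtain ⟨n, rfl⟩ := Nat.exists_eq_add_of_le' hK
  have hi := hα i
  have hj := hα j
  have hS : 0 < ∑ l, α l := sum_pos (fun l _ => hα l) ⟨i, mem_univ i⟩
  refine ⟨?_, ?_, fun k hki hkj => ?_⟩
  · rw [dblIntegral_sq_mul_likeL hα hij hμ hν i]
    simp only [Pi.add_apply, Pi.single_eq_same, Pi.single_eq_of_ne hij.symm, add_zero]
    congr 1
    rw [hη, add_right_comm]
    field_simp
    ring
  · rw [dblIntegral_sq_mul_likeL hα hij hμ hν j]
    simp only [Pi.add_apply, Pi.single_eq_same, Pi.single_eq_of_ne hij, add_zero]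
    congr 1
    rw [hη, ← add_assoc]
    field_simp
    ring
  · rw [dblIntegral_sq_mul_likeL hα hij hμ hν k]
    simp only [Pi.add_apply, Pi.single_eq_of_ne hki.symm, Pi.single_eq_of_ne hkj.symm, add_zero]
    rw [div_self (by positivity), div_self (by positivity), one_mul, one_mul]
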